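/- The matrix elements of the modified type-I K-operator in the theta basis are K_k(ξ)_{a,c} = [θ₁((2ν+2a−2ξ)/k, τ/k)·θ₁′(0, τ/k) / (k·θ₁((2ν+c+a)/k, τ/k)·θ₁((−2ξ−c+a)/k, τ/k))]·θ_c((−ν−ξ)/k)/θ_a((−ν+ξ)/k), i.e., K_k(ξ)θ_a = Σ_{c∈ℤ_k} K_k(ξ)_{a,c} θ_c. -/

import Mathlib

open Complex

/-- Jacobi theta function `θ₁(z,τ) = Σ_{n∈ℤ+1/2} exp(iπn²τ + 2πin(z+1/2))`. -/
noncomputable def theta1 (z τ : ℂ) : ℂ :=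
  ∑' n : ℤ, Complex.exp (Real.pi * I * ((n : ℂ) + 1/2)^2 * τ +
    2 * Real.pi * I * ((n : ℂ) + 1/2) * (z + 1/2))

/-- `θ₁′(0,τ)`, the derivative of `θ₁` in the first variable at `0`. -/
noncomputable def theta1'0 (τ : ℂ) : ℂ := deriv (fun w => theta1 w τ) 0

/-- The function `σ_μ(z) = θ₁(z−μ,τ)θ₁′(0,τ)/(θ₁(z,τ)θ₁(−μ,τ))`. -/
noncomputable def sigmaE (τ μ z : ℂ) : ℂ :=
  theta1 (z - μ) τ * theta1'0 τ / (theta1 z τ * theta1 (-μ) τ)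

/-- The lattice `ℤ + τℤ`. -/
def lattice (τ : ℂ) : Set ℂ := {w | ∃ m n : ℤ, w = (m : ℂ) + (n : ℂ) * τ}

/-- Theta basis of V_k: θ_a(z) = Σ_{n∈ℤ} exp(πin²τ/k + 2πin(z − a/k)), a ∈ ℤ/kℤ. -/
noncomputable def thetaA (τ : ℂ) (k : ℕ) (a : ZMod k) (z : ℂ) : ℂ :=
  ∑' n : ℤ, Complex.exp (Real.pi * I * (n : ℂ) ^ 2 * τ / k +
    2 * Real.pi * I * (n : ℂ) * (z - (a.val : ℂ) / k))

/-- Matrix elements of the modified type-I K-operator: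
K_k(ξ)_{a,c} = [θ₁((2ν+2a−2ξ)/k, τ/k) θ₁′(0, τ/k) /
(k θ₁((2ν+c+a)/k, τ/k) θ₁((−2ξ−c+a)/k, τ/k))] · θ_c((−ν−ξ)/k)/θ_a((−ν+ξ)/k). -/
noncomputable def belavinKI (τ : ℂ) (k : ℕ) (ν ξ : ℂ) (a c : ZMod k) : ℂ :=
  theta1 ((2 * ν + 2 * (a.val : ℂ) - 2 * ξ) / k) (τ / k) * theta1'0 (τ / k) /
    ((k : ℂ) * theta1 ((2 * ν + (c.val : ℂ) + (a.val : ℂ)) / k) (τ / k) *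
      theta1 ((-2 * ξ - (c.val : ℂ) + (a.val : ℂ)) / k) (τ / k)) *
    (thetaA τ k c ((-ν - ξ) / k) / thetaA τ k a ((-ν + ξ) / k))

/-- The integral of an entire `1`-periodic function over a horizontal period does not depend on
the base point. -/
lemma intervalIntegral_eq_of_periodic {f : ℂ → ℂ} (hf : Differentiable ℂ f)
    (hper : ∀ z, f (z + 1) = f z) (w : ℂ) :
    ∫ x : ℝ in (0 : ℝ)..1, f x = ∫ x : ℝ in (0 : ℝ)..1, f (x + w) := by
  have hrect := Complex.integral_boundary_rect_eq_zero_of_differentiableOn f 0 (1 + w.im * I)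
    hf.differentiableOn
  have hside : ∫ y : ℝ in (0 : ℝ)..w.im, f (1 + y * I) = ∫ y : ℝ in (0 : ℝ)..w.im, f (y * I) :=
    intervalIntegral.integral_congr fun y _ => by simp only [add_comm (1 : ℂ), hper]
  simp only [zero_re, zero_im, add_re, one_re, mul_re, ofReal_re, I_re, mul_zero, ofReal_im, I_im,
    mul_one, sub_self, add_zero, add_im, one_im, mul_im, zero_add, ofReal_zero, zero_mul,
    ofReal_one, hside, smul_eq_mul, add_sub_cancel_right] at hrect
  rw [sub_eq_zero.mp hrect]
  have hper' : Function.Periodic (fun x : ℝ => f (x + w.im * I)) 1 := fun x => by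
    simp only [ofReal_add, ofReal_one]
    rw [add_right_comm, hper]
  have hshift := hper'.intervalIntegral_add_eq 0 w.re
  have htrans := intervalIntegral.integral_comp_add_right (a := 0) (b := 1)
    (fun x : ℝ => f (x + w.im * I)) w.re
  rw [zero_add, add_comm (1 : ℝ)] at htrans
  rw [zero_add] at hshift
  rw [hshift, ← htrans]
  refine intervalIntegral.integral_congr fun x _ => ?_
  simp only [ofReal_add, add_assoc, re_add_im]

lemma fourierCoeff_quasiPeriodic {τ : ℂ} {g : ℂ → ℂ} (hg : Differentiable ℂ g)
    (h1 : ∀ z, g (z + 1) = g z)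
    (hτ : ∀ z, g (z + τ) = exp (-Real.pi * I * τ - 2 * Real.pi * I * z) * g z) (n : ℤ) :
    ∫ x : ℝ in (0 : ℝ)..1, exp (-2 * Real.pi * I * n * x) * g x =
      exp (Real.pi * I * n ^ 2 * τ) * ∫ x : ℝ in (0 : ℝ)..1, g x := by
  have step : ∀ m : ℤ, ∫ x : ℝ in (0 : ℝ)..1, exp (-2 * Real.pi * I * m * x) * g x =
      exp (-Real.pi * I * (2 * m + 1) * τ) *
        ∫ x : ℝ in (0 : ℝ)..1, exp (-2 * Real.pi * I * (m + 1 : ℤ) * x) * g x := by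
    intro m
    rw [intervalIntegral_eq_of_periodic (f := fun z => exp (-2 * Real.pi * I * m * z) * g z)
      (by fun_prop) (fun z => ?_) τ, ← intervalIntegral.integral_const_mul]
    · refine intervalIntegral.integral_congr fun x _ => ?_
      simp only [hτ, ← mul_assoc, ← Complex.exp_add]
      congr 2
      push_cast
      ring
    · rw [h1]
      congr 1
      rw [Complex.exp_eq_exp_iff_exists_int]
      exact ⟨-m, by push_cast; ring⟩
  induction n using Int.induction_on with
  | zero => simp
  | succ m ih =>
    have h := step m
    rw [ih] at h
    have := congrArg (exp (Real.pi * I * (2 * m + 1) * τ) * ·) h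
    simp only [← mul_assoc, ← Complex.exp_add] at this
    convert this.symm using 2
    · convert (one_mul _).symm
      · rw [← Complex.exp_zero]; congr 1; push_cast; ring
    · congr 1; push_cast; ring
  | pred m ih =>
    have h := step (-m - 1)
    rw [sub_add_cancel, ih, ← mul_assoc, ← Complex.exp_add] at h
    rw [h]
    congr 2
    push_cast
    ring

/-- Entire functions with the quasi-periodicity of `jacobiTheta₂` are multiples of it. -/
lemma exists_eq_const_mul_jacobiTheta₂ {τ : ℂ} (him : 0 < τ.im) {g : ℂ → ℂ}
    (hg : Differentiable ℂ g) (h1 : ∀ z, g (z + 1) = g z)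
    (hτ : ∀ z, g (z + τ) = exp (-Real.pi * I * τ - 2 * Real.pi * I * z) * g z) :
    ∃ C : ℂ, ∀ z, g z = C * jacobiTheta₂ z τ := by
  set C := ∫ x : ℝ in (0 : ℝ)..1, g x with hC
  refine ⟨C, fun z => ?_⟩
  have hper : Function.Periodic (fun x : ℝ => g x) 1 := fun x => by simp [h1]
  let F : C(AddCircle (1 : ℝ), ℂ) := ⟨hper.lift, by
    have : Continuous (fun x : ℝ => g x) := hg.continuous.comp continuous_ofReal
    exact continuous_coinduced_dom.mpr this⟩
  have hF : ∀ x : ℝ, F x = g x := fun x => hper.lift_coe x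
  have : Fact ((0 : ℝ) < 1) := ⟨one_pos⟩
  have hcoef : ∀ n : ℤ, fourierCoeff F n = C * exp (Real.pi * I * n ^ 2 * τ) := fun n => by
    rw [fourierCoeff_eq_intervalIntegral F n 0, mul_comm, hC,
      ← fourierCoeff_quasiPeriodic hg h1 hτ n]
    simp only [div_one, zero_add, one_smul, hF, fourier_coe_apply, smul_eq_mul]
    refine intervalIntegral.integral_congr fun x _ => ?_
    congr 2
    push_cast
    ring
  have hsum : ∀ x : ℝ, HasSum (fun n : ℤ => C * jacobiTheta₂_term n x τ)
      (C * jacobiTheta₂ x τ) := fun x => (hasSum_jacobiTheta₂_term x him).mul_left C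
  have hterm : ∀ (n : ℤ) (x : ℝ), fourierCoeff F n • fourier n (x : AddCircle (1 : ℝ)) =
      C * jacobiTheta₂_term n x τ := fun n x => by
    rw [hcoef, fourier_coe_apply, smul_eq_mul, mul_assoc, ← Complex.exp_add, jacobiTheta₂_term]
    congr 2
    push_cast
    ring
  have hcoef_summable : Summable (fourierCoeff F) := by
    refine (hsum 0).summable.congr fun n => ?_
    rw [← hterm]
    simp
  have hreal : ∀ x : ℝ, g x = C * jacobiTheta₂ x τ := fun x => by
    have h := has_pointwise_sum_fourier_series_of_summable hcoef_summable (x : AddCircle (1 : ℝ))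
    simp only [hterm, hF] at h
    exact h.unique (hsum x)
  have hJ : Differentiable ℂ fun z => C * jacobiTheta₂ z τ := fun z =>
    (differentiableAt_jacobiTheta₂_fst z him).const_mul C
  refine congrFun (AnalyticOnNhd.eq_of_frequently_eq (z₀ := 0)
    (fun z _ => hg.analyticAt z) (fun z _ => hJ.analyticAt z) ?_) z
  have htend : Filter.Tendsto (fun x : ℝ => (x : ℂ)) (nhdsWithin 0 {0}ᶜ) (nhdsWithin 0 {0}ᶜ) :=
    tendsto_nhdsWithin_iff.mpr ⟨by
      simpa using (continuous_ofReal.tendsto (0 : ℝ)).mono_left nhdsWithin_le_nhds, by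
      filter_upwards [self_mem_nhdsWithin] with x hx
      simpa using hx⟩
  exact htend.frequently (Filter.Frequently.of_forall hreal)

lemma theta1_eq_jacobiTheta₂ (z τ : ℂ) :
    theta1 z τ = exp (Real.pi * I * τ / 4 + Real.pi * I * (z + 1 / 2)) *
      jacobiTheta₂ (z + 1 / 2 + τ / 2) τ := by
  rw [theta1, jacobiTheta₂, ← tsum_mul_left]
  refine tsum_congr fun n => ?_
  rw [jacobiTheta₂_term, ← Complex.exp_add]
  congr 1
  ring

lemma jacobiTheta₂_eq_theta1 (z τ : ℂ) :
    jacobiTheta₂ z τ = exp (Real.pi * I * τ / 4 - Real.pi * I * z) *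
      theta1 (z - 1 / 2 - τ / 2) τ := by
  rw [theta1_eq_jacobiTheta₂, ← mul_assoc, ← Complex.exp_add,
    show z - 1 / 2 - τ / 2 + 1 / 2 + τ / 2 = z by ring]
  convert (one_mul _).symm
  rw [← Complex.exp_zero]
  congr 1
  ring

lemma thetaA_eq_jacobiTheta₂ (τ : ℂ) (k : ℕ) (a : ZMod k) (z : ℂ) :
    thetaA τ k a z = jacobiTheta₂ (z - (a.val : ℂ) / k) (τ / k) := by
  rw [thetaA, jacobiTheta₂]
  refine tsum_congr fun n => ?_
  rw [jacobiTheta₂_term]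
  congr 1
  ring

lemma theta1_add_one (z τ : ℂ) : theta1 (z + 1) τ = -theta1 z τ := by
  rw [theta1_eq_jacobiTheta₂, theta1_eq_jacobiTheta₂,
    show z + 1 + 1 / 2 + τ / 2 = z + 1 / 2 + τ / 2 + 1 by ring, jacobiTheta₂_add_left,
    show Real.pi * I * τ / 4 + Real.pi * I * (z + 1 + 1 / 2) =
      Real.pi * I * τ / 4 + Real.pi * I * (z + 1 / 2) + Real.pi * I by ring,
    Complex.exp_add _ (Real.pi * I), Complex.exp_pi_mul_I]
  ring

lemma neg_exp_eq (w : ℂ) : -exp w = exp (w + Real.pi * I) := by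
  rw [Complex.exp_add, Complex.exp_pi_mul_I, mul_neg_one]

lemma theta1_add_tau (z τ : ℂ) :
    theta1 (z + τ) τ = -exp (-Real.pi * I * τ - 2 * Real.pi * I * z) * theta1 z τ := by
  rw [theta1_eq_jacobiTheta₂, theta1_eq_jacobiTheta₂,
    show z + τ + 1 / 2 + τ / 2 = z + 1 / 2 + τ / 2 + τ by ring, jacobiTheta₂_add_left',
    ← mul_assoc, ← mul_assoc, ← Complex.exp_add, neg_exp_eq, ← Complex.exp_add]
  congr 1
  rw [Complex.exp_eq_exp_iff_exists_int]
  exact ⟨-1, by push_cast; ring⟩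

lemma theta1_neg (z τ : ℂ) : theta1 (-z) τ = -theta1 z τ := by
  rw [theta1_eq_jacobiTheta₂, theta1_eq_jacobiTheta₂, ← jacobiTheta₂_neg_left,
    show z + 1 / 2 + τ / 2 = -(-z + 1 / 2 + τ / 2) + 1 + τ by ring, jacobiTheta₂_add_left',
    jacobiTheta₂_add_left, ← neg_mul, ← mul_assoc, neg_exp_eq, ← Complex.exp_add]
  congr 1
  rw [Complex.exp_eq_exp_iff_exists_int]
  exact ⟨0, by push_cast; ring⟩

lemma theta1_zero (τ : ℂ) : theta1 0 τ = 0 := by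
  have h := theta1_neg 0 τ
  rw [neg_zero] at h
  exact self_eq_neg.mp h

lemma differentiable_theta1 {τ : ℂ} (him : 0 < τ.im) : Differentiable ℂ fun z => theta1 z τ := by
  have hJ : Differentiable ℂ fun z => jacobiTheta₂ z τ := fun z =>
    differentiableAt_jacobiTheta₂_fst z him
  simp only [theta1_eq_jacobiTheta₂]
  exact Differentiable.mul (by fun_prop)
    (hJ.comp (by fun_prop : Differentiable ℂ fun z : ℂ => z + 1 / 2 + τ / 2))

/-- Entire functions with the quasi-periodicity of a translate of `theta1` are multiples of it. -/
lemma exists_eq_const_mul_theta1 {τ : ℂ} (him : 0 < τ.im) (μ : ℂ) {f : ℂ → ℂ}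
    (hf : Differentiable ℂ f) (h1 : ∀ z, f (z + 1) = -f z)
    (hτ : ∀ z, f (z + τ) = -exp (-Real.pi * I * τ - 2 * Real.pi * I * (z - μ)) * f z) :
    ∃ C : ℂ, ∀ z, f z = C * theta1 (z - μ) τ := by
  obtain ⟨C, hC⟩ := exists_eq_const_mul_jacobiTheta₂ him
    (g := fun u => exp (-Real.pi * I * u) * f (u - 1 / 2 - τ / 2 + μ))
    (Differentiable.mul (by fun_prop)
      (hf.comp (by fun_prop : Differentiable ℂ fun u : ℂ => u - 1 / 2 - τ / 2 + μ)))
    (fun u => by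
      rw [show u + 1 - 1 / 2 - τ / 2 + μ = u - 1 / 2 - τ / 2 + μ + 1 by ring, h1, mul_neg,
        ← neg_mul, neg_exp_eq]
      congr 2
      ring)
    (fun u => by
      rw [show u + τ - 1 / 2 - τ / 2 + μ = u - 1 / 2 - τ / 2 + μ + τ by ring, hτ, ← mul_assoc,
        ← mul_assoc, neg_exp_eq, ← Complex.exp_add, ← Complex.exp_add]
      congr 1
      rw [Complex.exp_eq_exp_iff_exists_int]
      exact ⟨1, by push_cast; ring⟩)
  refine ⟨C * exp (Real.pi * I * τ / 4), fun z => ?_⟩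
  have h := hC (z + 1 / 2 + τ / 2 - μ)
  rw [jacobiTheta₂_eq_theta1, show z + 1 / 2 + τ / 2 - μ - 1 / 2 - τ / 2 + μ = z by ring,
    show z + 1 / 2 + τ / 2 - μ - 1 / 2 - τ / 2 = z - μ by ring, Complex.exp_sub, neg_mul, neg_mul,
    Complex.exp_neg] at h
  field_simp at h
  linear_combination h

lemma summable_theta1_summand {τ : ℂ} (him : 0 < τ.im) (z : ℂ) :
    Summable fun n : ℤ => exp (Real.pi * I * ((n : ℂ) + 1 / 2) ^ 2 * τ +
      2 * Real.pi * I * ((n : ℂ) + 1 / 2) * z) := by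
  refine (((summable_jacobiTheta₂_term_iff (z + τ / 2) τ).mpr him).mul_left
    (exp (Real.pi * I * τ / 4 + Real.pi * I * z))).congr fun n => ?_
  rw [jacobiTheta₂_term, ← Complex.exp_add]
  congr 1
  ring

/-- Change of summation indices `(n, m) = (p + q, p - q - ε)`, `ε ∈ {0, 1}`. -/
def sumDiffEquiv : Bool × (ℤ × ℤ) ≃ ℤ × ℤ where
  toFun x := (x.2.1 + x.2.2, x.2.1 - x.2.2 - if x.1 then 1 else 0)
  invFun y := (decide ((y.1 + y.2) % 2 = 1), ((y.1 + y.2 + 1) / 2, y.1 - (y.1 + y.2 + 1) / 2))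
  left_inv := by
    rintro ⟨ε, p, q⟩
    cases ε
    · simp only [Prod.mk.injEq, decide_eq_false_iff_not, Bool.false_eq_true, if_false]
      omega
    · simp only [Prod.mk.injEq, decide_eq_true_eq, if_true]
      omega
  right_inv := by
    rintro ⟨n, m⟩
    by_cases h : (n + m) % 2 = 1
    · simp only [h, decide_true, if_true, Prod.mk.injEq]
      omega
    · simp only [h, decide_false, Bool.false_eq_true, if_false, Prod.mk.injEq]
      omega

/-- The product `θ₁(x + y) θ₁(x - y)` is an alternating bilinear expression. -/
lemma exists_theta1_add_mul_theta1_sub {τ : ℂ} (him : 0 < τ.im) :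
    ∃ u v : ℂ → ℂ, ∀ x y, theta1 (x + y) τ * theta1 (x - y) τ = u x * v y - v x * u y := by
  have him2 : 0 < (2 * τ).im := by simpa using him
  set U : ℂ → ℤ → ℂ := fun x p => exp (2 * Real.pi * I * (p : ℂ) ^ 2 * τ +
    4 * Real.pi * I * p * x) with hU
  set V : ℂ → ℤ → ℂ := fun x p => exp (2 * Real.pi * I * ((p : ℂ) + 1 / 2) ^ 2 * τ +
    4 * Real.pi * I * ((p : ℂ) + 1 / 2) * x) with hV
  have hUs : ∀ x, Summable (U x) := fun x =>
    ((summable_jacobiTheta₂_term_iff (2 * x) (2 * τ)).mpr him2).congr fun n => by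
      rw [jacobiTheta₂_term, hU]
      congr 1
      ring
  have hVs : ∀ x, Summable (V x) := fun x =>
    (summable_theta1_summand him2 (2 * x)).congr fun n => by
      rw [hV]
      congr 1
      ring
  have hUV : ∀ x y, Summable fun s : ℤ × ℤ => U x s.1 * V y s.2 := fun x y =>
    summable_mul_of_summable_norm (hUs x).norm (hVs y).norm
  have hVU : ∀ x y, Summable fun s : ℤ × ℤ => V x s.1 * U y s.2 := fun x y =>
    summable_mul_of_summable_norm (hVs x).norm (hUs y).norm
  refine ⟨fun x => ∑' p, U x p, fun x => ∑' p, V x p, fun x y => ?_⟩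
  simp only [theta1]
  rw [tsum_mul_tsum_of_summable_norm (summable_theta1_summand him _).norm
      (summable_theta1_summand him _).norm,
    tsum_mul_tsum_of_summable_norm (hUs x).norm (hVs y).norm,
    tsum_mul_tsum_of_summable_norm (hVs x).norm (hUs y).norm, ← sumDiffEquiv.tsum_eq]
  have htrue : ∀ s : ℤ × ℤ, exp (Real.pi * I * (((sumDiffEquiv (true, s)).1 : ℂ) + 1 / 2) ^ 2 * τ +
      2 * Real.pi * I * (((sumDiffEquiv (true, s)).1 : ℂ) + 1 / 2) * (x + y + 1 / 2)) *
      exp (Real.pi * I * (((sumDiffEquiv (true, s)).2 : ℂ) + 1 / 2) ^ 2 * τ +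
      2 * Real.pi * I * (((sumDiffEquiv (true, s)).2 : ℂ) + 1 / 2) * (x - y + 1 / 2)) =
      U x s.1 * V y s.2 := fun s => by
    rw [hU, hV, ← Complex.exp_add, ← Complex.exp_add, Complex.exp_eq_exp_iff_exists_int]
    exact ⟨s.1, by simp only [sumDiffEquiv, Equiv.coe_fn_mk, if_true]; push_cast; ring⟩
  have hfalse : ∀ s : ℤ × ℤ,
      exp (Real.pi * I * (((sumDiffEquiv (false, s)).1 : ℂ) + 1 / 2) ^ 2 * τ +
      2 * Real.pi * I * (((sumDiffEquiv (false, s)).1 : ℂ) + 1 / 2) * (x + y + 1 / 2)) *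
      exp (Real.pi * I * (((sumDiffEquiv (false, s)).2 : ℂ) + 1 / 2) ^ 2 * τ +
      2 * Real.pi * I * (((sumDiffEquiv (false, s)).2 : ℂ) + 1 / 2) * (x - y + 1 / 2)) =
      -(V x s.1 * U y s.2) := fun s => by
    rw [hU, hV, ← Complex.exp_add, ← Complex.exp_add, neg_exp_eq,
      Complex.exp_eq_exp_iff_exists_int]
    exact ⟨s.1, by
      simp only [sumDiffEquiv, Equiv.coe_fn_mk, Bool.false_eq_true, if_false]; push_cast; ring⟩
  have hsum : Summable fun c : Bool × (ℤ × ℤ) =>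
      exp (Real.pi * I * (((sumDiffEquiv c).1 : ℂ) + 1 / 2) ^ 2 * τ +
      2 * Real.pi * I * (((sumDiffEquiv c).1 : ℂ) + 1 / 2) * (x + y + 1 / 2)) *
      exp (Real.pi * I * (((sumDiffEquiv c).2 : ℂ) + 1 / 2) ^ 2 * τ +
      2 * Real.pi * I * (((sumDiffEquiv c).2 : ℂ) + 1 / 2) * (x - y + 1 / 2)) :=
    sumDiffEquiv.summable_iff.mpr (summable_mul_of_summable_norm
      (summable_theta1_summand him (x + y + 1 / 2)).norm
      (summable_theta1_summand him (x - y + 1 / 2)).norm)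
  rw [hsum.tsum_prod, tsum_bool]
  simp only [htrue, hfalse, tsum_neg]
  ring

/-- Weierstrass' three-term identity. -/
lemma theta1_weierstrass {τ : ℂ} (him : 0 < τ.im) (x y z t : ℂ) :
    theta1 (x + y) τ * theta1 (x - y) τ * (theta1 (z + t) τ * theta1 (z - t) τ) -
      theta1 (x + z) τ * theta1 (x - z) τ * (theta1 (y + t) τ * theta1 (y - t) τ) +
      theta1 (x + t) τ * theta1 (x - t) τ * (theta1 (y + z) τ * theta1 (y - z) τ) = 0 := by
  obtain ⟨u, v, h⟩ := exists_theta1_add_mul_theta1_sub him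
  simp only [h]
  ring

lemma theta1_mul_jacobiTheta₂_three_term {τ : ℂ} (him : 0 < τ.im) (w A B : ℂ) :
    theta1 (w - A) τ * theta1 B τ *
        (jacobiTheta₂ (w + (A - B) / 2) τ * jacobiTheta₂ ((A - B) / 2) τ) +
      theta1 (w - B) τ * theta1 (-A) τ *
        (jacobiTheta₂ (w - (A - B) / 2) τ * jacobiTheta₂ ((A - B) / 2) τ) =
    theta1 w τ * theta1 (B - A) τ *
      (jacobiTheta₂ (-((A + B) / 2)) τ * jacobiTheta₂ (w - (A + B) / 2) τ) := by
  have hmul : ∀ p q, jacobiTheta₂ p τ * jacobiTheta₂ q τ =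
      exp (Real.pi * I * τ / 2 - Real.pi * I * (p + q)) *
        (theta1 (p - 1 / 2 - τ / 2) τ * theta1 (q - 1 / 2 - τ / 2) τ) := fun p q => by
    rw [jacobiTheta₂_eq_theta1, jacobiTheta₂_eq_theta1 q, mul_mul_mul_comm, ← Complex.exp_add]
    congr 2
    ring
  have h := theta1_weierstrass him ((w + B - A) / 2) ((w - B + A) / 2)
    (w / 2 - 1 / 2 - τ / 2) ((A + B - w) / 2)
  rw [show (A - B) / 2 = -((B - A) / 2) by ring, jacobiTheta₂_neg_left, hmul,
    ← jacobiTheta₂_neg_left ((B - A) / 2), hmul, jacobiTheta₂_neg_left, hmul]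
  rw [show (w + B - A) / 2 + (w - B + A) / 2 = w by ring,
    show (w + B - A) / 2 - (w - B + A) / 2 = B - A by ring,
    show w / 2 - 1 / 2 - τ / 2 + (A + B - w) / 2 = (A + B) / 2 - 1 / 2 - τ / 2 by ring,
    show w / 2 - 1 / 2 - τ / 2 - (A + B - w) / 2 = w - (A + B) / 2 - 1 / 2 - τ / 2 by ring,
    show (w + B - A) / 2 + (w / 2 - 1 / 2 - τ / 2) = w - -((B - A) / 2) - 1 / 2 - τ / 2 by ring,
    show (w + B - A) / 2 - (w / 2 - 1 / 2 - τ / 2) = -(-((B - A) / 2) - 1 / 2 - τ / 2) by ring,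
    show (w - B + A) / 2 + (A + B - w) / 2 = A by ring,
    show (w - B + A) / 2 - (A + B - w) / 2 = w - B by ring,
    show (w + B - A) / 2 + (A + B - w) / 2 = B by ring,
    show (w + B - A) / 2 - (A + B - w) / 2 = w - A by ring,
    show (w - B + A) / 2 + (w / 2 - 1 / 2 - τ / 2) = w + -((B - A) / 2) - 1 / 2 - τ / 2 by ring,
    show (w - B + A) / 2 - (w / 2 - 1 / 2 - τ / 2) = -((B - A) / 2 - 1 / 2 - τ / 2) by ring] at h
  simp only [theta1_neg] at h ⊢
  rw [show w + -((B - A) / 2) + (B - A) / 2 = w by ring,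
    show w - -((B - A) / 2) + -((B - A) / 2) = w by ring,
    show (A + B) / 2 + (w - (A + B) / 2) = w by ring]
  linear_combination -exp (Real.pi * I * τ / 2 - Real.pi * I * w) * h

/-- The entire function `G` with `G(z) θ₁(z, τ)` proportional to `θ₁(z, s)` when
`τ = (m + 1) s`. -/
noncomputable def theta1Cofactor (m : ℕ) (s τ z : ℂ) : ℂ :=
  exp (Real.pi * I * m * z) * ∏ j ∈ Finset.range m, theta1 (z + ((j : ℂ) + 1) * s) τ

section Cofactor

variable {m : ℕ} {s τ : ℂ}

lemma exp_pi_mul_I_mul_nat (n : ℕ) : exp (Real.pi * I * n) = (-1) ^ n := by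
  rw [mul_comm, Complex.exp_nat_mul, Complex.exp_pi_mul_I]

lemma differentiable_theta1Cofactor (him : 0 < τ.im) :
    Differentiable ℂ (theta1Cofactor m s τ) := by
  unfold theta1Cofactor
  refine Differentiable.mul (by fun_prop) (Differentiable.fun_finsetProd fun j _ => ?_)
  exact (differentiable_theta1 him).comp
    (by fun_prop : Differentiable ℂ fun z : ℂ => z + ((j : ℂ) + 1) * s)

lemma theta1Cofactor_add_one (z : ℂ) :
    theta1Cofactor m s τ (z + 1) = theta1Cofactor m s τ z := by
  have hprod : ∏ j ∈ Finset.range m, theta1 (z + 1 + ((j : ℂ) + 1) * s) τ =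
      (-1) ^ m * ∏ j ∈ Finset.range m, theta1 (z + ((j : ℂ) + 1) * s) τ := by
    simp only [add_right_comm z 1, theta1_add_one, Finset.prod_neg, Finset.card_range]
  rw [theta1Cofactor, theta1Cofactor, hprod, mul_add, mul_one, Complex.exp_add,
    exp_pi_mul_I_mul_nat, mul_assoc, ← mul_assoc ((-1 : ℂ) ^ m), ← mul_pow]
  simp

lemma theta1Cofactor_add_tau (hs : τ = (m + 1) * s) (z : ℂ) :
    theta1Cofactor m s τ (z + τ) =
      (-1) ^ m * exp (-Real.pi * I * m * τ - 2 * Real.pi * I * m * z) *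
        theta1Cofactor m s τ z := by
  have hprod : ∀ n : ℕ, ∏ j ∈ Finset.range n, theta1 (z + τ + ((j : ℂ) + 1) * s) τ =
      (-1) ^ n * exp (-Real.pi * I * n * τ - 2 * Real.pi * I * n * z -
        Real.pi * I * n * (n + 1) * s) *
        ∏ j ∈ Finset.range n, theta1 (z + ((j : ℂ) + 1) * s) τ := by
    intro n
    induction n with
    | zero => simp
    | succ n ih =>
      rw [Finset.prod_range_succ, ih, Finset.prod_range_succ, add_right_comm z τ, theta1_add_tau,
        show -Real.pi * I * ((n + 1 : ℕ) : ℂ) * τ - 2 * Real.pi * I * ((n + 1 : ℕ) : ℂ) * z -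
          Real.pi * I * ((n + 1 : ℕ) : ℂ) * (((n + 1 : ℕ) : ℂ) + 1) * s =
          (-Real.pi * I * n * τ - 2 * Real.pi * I * n * z - Real.pi * I * n * (n + 1) * s) +
          (-Real.pi * I * τ - 2 * Real.pi * I * (z + ((n : ℂ) + 1) * s)) by push_cast; ring,
        Complex.exp_add, pow_succ]
      ring
  have hexp : exp (Real.pi * I * m * (z + τ)) * exp (-Real.pi * I * m * τ -
      2 * Real.pi * I * m * z - Real.pi * I * m * (m + 1) * s) =
      exp (-Real.pi * I * m * τ - 2 * Real.pi * I * m * z) * exp (Real.pi * I * m * z) := by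
    rw [← Complex.exp_add, ← Complex.exp_add, hs]
    congr 1
    ring
  rw [theta1Cofactor, theta1Cofactor, hprod]
  linear_combination (-1) ^ m *
    (∏ j ∈ Finset.range m, theta1 (z + ((j : ℂ) + 1) * s) τ) * hexp

lemma theta1Cofactor_eq_zero (hs : τ = (m + 1) * s) {j : ℕ} (hj0 : 0 < j) (hj : j < m + 1) :
    theta1Cofactor m s τ (j * s) = 0 := by
  have hmem : m - j ∈ Finset.range m := Finset.mem_range.mpr (by omega)
  rw [theta1Cofactor, Finset.prod_eq_zero hmem, mul_zero]
  rw [show (j : ℂ) * s + (((m - j : ℕ) : ℂ) + 1) * s = 0 + τ by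
    rw [hs, Nat.cast_sub (by omega)]; ring, theta1_add_tau, theta1_zero, mul_zero]

lemma exists_theta1Cofactor_mul_theta1 (him : 0 < τ.im) (hims : 0 < s.im)
    (hs : τ = (m + 1) * s) :
    ∃ C : ℂ, ∀ z, theta1Cofactor m s τ z * theta1 z τ = C * theta1 z s := by
  obtain ⟨C, hC⟩ := exists_eq_const_mul_theta1 hims 0
    (f := fun z => theta1Cofactor m s τ z * theta1 z τ)
    ((differentiable_theta1Cofactor him).mul (differentiable_theta1 him))
    (fun z => by rw [theta1Cofactor_add_one, theta1_add_one, mul_neg])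
    (fun z => by
      have hprod : (∏ j ∈ Finset.range m, theta1 (z + s + ((j : ℂ) + 1) * s) τ) *
          theta1 (z + s) τ = (∏ j ∈ Finset.range m, theta1 (z + ((j : ℂ) + 1) * s) τ) *
          theta1 (z + τ) τ := by
        have h := Finset.prod_range_succ' (fun j : ℕ => theta1 (z + s + (j : ℂ) * s) τ) m
        have h' := Finset.prod_range_succ (fun j : ℕ => theta1 (z + ((j : ℂ) + 1) * s) τ) m
        have hterm : ∀ j : ℕ, z + s + (j : ℂ) * s = z + ((j : ℂ) + 1) * s := fun j => by ring
        simp only [Nat.cast_add, Nat.cast_one, Nat.cast_zero, zero_mul, add_zero] at h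
        simp only [hterm, h', ← hs] at h
        exact h.symm
      have hexp : exp (Real.pi * I * m * (z + s)) *
          exp (-Real.pi * I * τ - 2 * Real.pi * I * z) =
          exp (Real.pi * I * m * z) * exp (-Real.pi * I * s - 2 * Real.pi * I * (z - 0)) := by
        rw [← Complex.exp_add, ← Complex.exp_add, hs]
        congr 1
        ring
      rw [theta1_add_tau] at hprod
      rw [theta1Cofactor, theta1Cofactor]
      linear_combination exp (Real.pi * I * m * (z + s)) * hprod -
        (∏ j ∈ Finset.range m, theta1 (z + ((j : ℂ) + 1) * s) τ) * theta1 z τ * hexp)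
  exact ⟨C, fun z => by simpa using hC z⟩

/-- The iterates of `f ↦ (z ↦ -e^{πis + 2πiz} f(z + s))` on `G(z) θ₁(z - μ, τ)`. -/
noncomputable def shiftedTheta (m : ℕ) (s τ μ : ℂ) (j : ℕ) (z : ℂ) : ℂ :=
  (-1) ^ j * exp (Real.pi * I * (j : ℂ) ^ 2 * s + 2 * Real.pi * I * j * z) *
    (theta1Cofactor m s τ (z + j * s) * theta1 (z + j * s - μ) τ)

lemma shiftedTheta_zero (μ z : ℂ) :
    shiftedTheta m s τ μ 0 z = theta1Cofactor m s τ z * theta1 (z - μ) τ := by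
  simp [shiftedTheta]

lemma differentiable_shiftedTheta (him : 0 < τ.im) (μ : ℂ) (j : ℕ) :
    Differentiable ℂ (shiftedTheta m s τ μ j) := by
  unfold shiftedTheta
  refine Differentiable.mul (by fun_prop) (Differentiable.mul ?_ ?_)
  · exact (differentiable_theta1Cofactor him).comp
      (by fun_prop : Differentiable ℂ fun z : ℂ => z + j * s)
  · exact (differentiable_theta1 him).comp
      (by fun_prop : Differentiable ℂ fun z : ℂ => z + j * s - μ)

lemma shiftedTheta_add_one (μ z : ℂ) (j : ℕ) :
    shiftedTheta m s τ μ j (z + 1) = -shiftedTheta m s τ μ j z := by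
  have hexp : exp (Real.pi * I * (j : ℂ) ^ 2 * s + 2 * Real.pi * I * j * (z + 1)) =
      exp (Real.pi * I * (j : ℂ) ^ 2 * s + 2 * Real.pi * I * j * z) := by
    rw [Complex.exp_eq_exp_iff_exists_int]
    exact ⟨j, by push_cast; ring⟩
  rw [shiftedTheta, shiftedTheta, hexp, add_right_comm, theta1Cofactor_add_one,
    show z + j * s + 1 - μ = z + j * s - μ + 1 by ring, theta1_add_one]
  ring

lemma shiftedTheta_add_s (μ z : ℂ) (j : ℕ) :
    shiftedTheta m s τ μ j (z + s) =
      -exp (-Real.pi * I * s - 2 * Real.pi * I * z) * shiftedTheta m s τ μ (j + 1) z := by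
  have hexp : exp (Real.pi * I * (j : ℂ) ^ 2 * s + 2 * Real.pi * I * j * (z + s)) =
      exp (-Real.pi * I * s - 2 * Real.pi * I * z) *
      exp (Real.pi * I * ((j + 1 : ℕ) : ℂ) ^ 2 * s + 2 * Real.pi * I * ((j + 1 : ℕ) : ℂ) * z) := by
    rw [← Complex.exp_add]
    congr 1
    push_cast
    ring
  rw [shiftedTheta, shiftedTheta, hexp, show z + s + j * s = z + ((j + 1 : ℕ) : ℂ) * s by
    push_cast; ring, pow_succ]
  ring

lemma shiftedTheta_succ_eq (hs : τ = (m + 1) * s) (μ z : ℂ) :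
    shiftedTheta m s τ μ (m + 1) z =
      exp (2 * Real.pi * I * μ) * shiftedTheta m s τ μ 0 z := by
  have hexp : exp (Real.pi * I * ((m + 1 : ℕ) : ℂ) ^ 2 * s +
      2 * Real.pi * I * ((m + 1 : ℕ) : ℂ) * z) *
      exp (-Real.pi * I * m * τ - 2 * Real.pi * I * m * z) *
      exp (-Real.pi * I * τ - 2 * Real.pi * I * (z - μ)) = exp (2 * Real.pi * I * μ) := by
    rw [← Complex.exp_add, ← Complex.exp_add, hs]
    congr 1
    push_cast
    ring
  have hsign : ((-1 : ℂ) ^ m) * (-1) ^ m = 1 := by rw [← mul_pow]; simp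
  rw [shiftedTheta_zero, shiftedTheta, show ((m + 1 : ℕ) : ℂ) * s = τ by rw [hs]; push_cast; ring,
    theta1Cofactor_add_tau hs, add_sub_right_comm, theta1_add_tau, ← hexp, pow_succ]
  linear_combination (exp (Real.pi * I * ((m + 1 : ℕ) : ℂ) ^ 2 * s +
      2 * Real.pi * I * ((m + 1 : ℕ) : ℂ) * z) *
      exp (-Real.pi * I * m * τ - 2 * Real.pi * I * m * z) *
      exp (-Real.pi * I * τ - 2 * Real.pi * I * (z - μ)) * theta1Cofactor m s τ z *
      theta1 (z - μ) τ) * hsign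

lemma shiftedTheta_apply_zero (hs : τ = (m + 1) * s) (μ : ℂ) {j : ℕ} (hj0 : 0 < j)
    (hj : j < m + 1) : shiftedTheta m s τ μ j 0 = 0 := by
  rw [shiftedTheta, zero_add, theta1Cofactor_eq_zero hs hj0 hj]
  ring

/-- The eigencomponent of `G(z) θ₁(z - μ, τ)` is a multiple of `θ₁(z - ν, s)`. -/
lemma sum_shiftedTheta_mul (him : 0 < τ.im) (hims : 0 < s.im) (hs : τ = (m + 1) * s) {μ ν : ℂ}
    (hν : exp (2 * Real.pi * I * (m + 1) * ν) = exp (2 * Real.pi * I * μ)) (z : ℂ) :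
    (∑ j ∈ Finset.range (m + 1), exp (-2 * Real.pi * I * j * ν) * shiftedTheta m s τ μ j z) *
      theta1 (-ν) s =
    theta1Cofactor m s τ 0 * theta1 (-μ) τ * theta1 (z - ν) s := by
  obtain ⟨D, hD⟩ := exists_eq_const_mul_theta1 hims ν
    (f := fun z => ∑ j ∈ Finset.range (m + 1),
      exp (-2 * Real.pi * I * j * ν) * shiftedTheta m s τ μ j z)
    (Differentiable.fun_sum fun j _ => (differentiable_shiftedTheta him μ j).const_mul _)
    (fun z => by simp only [shiftedTheta_add_one, mul_neg, Finset.sum_neg_distrib])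
    (fun z => by
      have hterm : ∀ j : ℕ, exp (-2 * Real.pi * I * j * ν) * shiftedTheta m s τ μ j (z + s) =
          -exp (-Real.pi * I * s - 2 * Real.pi * I * (z - ν)) *
          (exp (-2 * Real.pi * I * (j + 1 : ℕ) * ν) * shiftedTheta m s τ μ (j + 1) z) := by
        intro j
        have hexp : exp (-2 * Real.pi * I * j * ν) *
            exp (-Real.pi * I * s - 2 * Real.pi * I * z) =
            exp (-Real.pi * I * s - 2 * Real.pi * I * (z - ν)) *
            exp (-2 * Real.pi * I * (j + 1 : ℕ) * ν) := by
          rw [← Complex.exp_add, ← Complex.exp_add]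
          congr 1
          push_cast
          ring
        rw [shiftedTheta_add_s]
        linear_combination -shiftedTheta m s τ μ (j + 1) z * hexp
      have hcancel : exp (-2 * Real.pi * I * (m + 1 : ℕ) * ν) * exp (2 * Real.pi * I * μ) = 1 := by
        rw [← hν, ← Complex.exp_add, Complex.exp_eq_one_iff]
        exact ⟨0, by push_cast; ring⟩
      have hlast : exp (-2 * Real.pi * I * (m + 1 : ℕ) * ν) * shiftedTheta m s τ μ (m + 1) z =
          exp (-2 * Real.pi * I * (0 : ℕ) * ν) * shiftedTheta m s τ μ 0 z := by
        rw [shiftedTheta_succ_eq hs, ← mul_assoc, hcancel]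
        simp
      simp only [hterm, ← Finset.mul_sum]
      congr 1
      rw [Finset.sum_range_succ, hlast]
      exact (Finset.sum_range_succ' (fun j : ℕ =>
        exp (-2 * Real.pi * I * j * ν) * shiftedTheta m s τ μ j z) m).symm)
  have h0 := hD 0
  rw [Finset.sum_eq_single_of_mem 0 (by simp) fun j hj hj0 => by
    rw [shiftedTheta_apply_zero hs μ (Nat.pos_of_ne_zero hj0) (Finset.mem_range.mp hj), mul_zero],
    shiftedTheta_zero, zero_sub, zero_sub] at h0
  rw [hD]
  simp only [Nat.cast_zero, mul_zero, zero_mul, Complex.exp_zero, one_mul] at h0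
  rw [h0]
  ring

lemma sum_range_exp_eq_zero {k j : ℕ} (hj0 : 0 < j) (hj : j < k) :
    ∑ c ∈ Finset.range k, exp (-2 * Real.pi * I * j * (c / k)) = 0 := by
  have hk : (k : ℂ) ≠ 0 := Nat.cast_ne_zero.mpr (by omega)
  have hpow : ∀ c : ℕ, exp (-2 * Real.pi * I * j * (c / k)) =
      exp (-2 * Real.pi * I * j / k) ^ c := fun c => by
    rw [← Complex.exp_nat_mul]
    congr 1
    ring
  have hne : exp (-2 * Real.pi * I * j / k) ≠ 1 := by
    rw [Ne, Complex.exp_eq_one_iff]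
    rintro ⟨n, hn⟩
    have h2 : (2 * Real.pi * I : ℂ) ≠ 0 := Complex.two_pi_I_ne_zero
    have h3 : -(j : ℂ) = n * k := by
      field_simp at hn
      exact mul_left_cancel₀ h2 (by linear_combination (2 * Real.pi * I) * hn)
    have h4 : -(j : ℤ) = n * k := by exact_mod_cast h3
    have h5 : (k : ℤ) ∣ j := ⟨-n, by linarith⟩
    exact absurd (Nat.le_of_dvd hj0 (Int.natCast_dvd_natCast.mp h5)) (by omega)
  simp only [hpow]
  have hgeom := mul_geom_sum (exp (-2 * Real.pi * I * j / k)) k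
  have hone : exp (-2 * Real.pi * I * j / k) ^ k = 1 := by
    rw [← Complex.exp_nat_mul, Complex.exp_eq_one_iff]
    exact ⟨-j, by field_simp; push_cast; ring⟩
  rw [hone, sub_self] at hgeom
  exact (mul_eq_zero.mp hgeom).resolve_left (sub_ne_zero.mpr hne)

/-- The expansion of `θ₁(z - μ, τ)` with respect to translates of `θ₁(z, s)`. -/
lemma theta1Cofactor_mul_theta1_sub (him : 0 < τ.im) (hims : 0 < s.im) (hs : τ = (m + 1) * s)
    (μ : ℂ) (n : ℤ)
    (hne : ∀ c ∈ Finset.range (m + 1), theta1 (-((μ + c + n) / (m + 1 : ℕ))) s ≠ 0) (z : ℂ) :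
    (m + 1 : ℕ) * (theta1Cofactor m s τ z * theta1 (z - μ) τ) =
      ∑ c ∈ Finset.range (m + 1), theta1Cofactor m s τ 0 * theta1 (-μ) τ *
        (theta1 (z - (μ + c + n) / (m + 1 : ℕ)) s / theta1 (-((μ + c + n) / (m + 1 : ℕ))) s) := by
  have hm : ((m + 1 : ℕ) : ℂ) ≠ 0 := Nat.cast_ne_zero.mpr (by omega)
  have hcomp : ∀ c ∈ Finset.range (m + 1), theta1Cofactor m s τ 0 * theta1 (-μ) τ *
        (theta1 (z - (μ + c + n) / (m + 1 : ℕ)) s / theta1 (-((μ + c + n) / (m + 1 : ℕ))) s) =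
      ∑ j ∈ Finset.range (m + 1), exp (-2 * Real.pi * I * j * ((μ + c + n) / (m + 1 : ℕ))) *
        shiftedTheta m s τ μ j z := fun c hc => by
    rw [← mul_div_assoc, ← sum_shiftedTheta_mul him hims hs, mul_div_cancel_right₀ _ (hne c hc)]
    rw [Complex.exp_eq_exp_iff_exists_int]
    refine ⟨c + n, ?_⟩
    push_cast at hm ⊢
    field_simp
    ring
  rw [Finset.sum_congr rfl hcomp, Finset.sum_comm, Finset.sum_eq_single_of_mem 0 (by simp)]
  · simp [shiftedTheta_zero]
  · intro j hj hj0
    have hsplit : ∀ c : ℕ, exp (-2 * Real.pi * I * j * ((μ + c + n) / (m + 1 : ℕ))) *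
        shiftedTheta m s τ μ j z = exp (-2 * Real.pi * I * j * ((μ + n) / (m + 1 : ℕ))) *
        shiftedTheta m s τ μ j z * exp (-2 * Real.pi * I * j * (c / (m + 1 : ℕ))) := fun c => by
      rw [mul_right_comm _ (shiftedTheta m s τ μ j z), ← Complex.exp_add]
      congr 2
      ring
    simp only [hsplit, ← Finset.mul_sum]
    rw [sum_range_exp_eq_zero (Nat.pos_of_ne_zero hj0) (Finset.mem_range.mp hj), mul_zero]

lemma theta1Cofactor_zero_mul_theta1'0 (him : 0 < τ.im) (hims : 0 < s.im) {C : ℂ}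
    (hC : ∀ z, theta1Cofactor m s τ z * theta1 z τ = C * theta1 z s) :
    theta1Cofactor m s τ 0 * theta1'0 τ = C * theta1'0 s := by
  have hl := ((differentiable_theta1Cofactor (m := m) (s := s) him) 0).hasDerivAt.mul
    ((differentiable_theta1 him) 0).hasDerivAt
  have hr := (((differentiable_theta1 hims) 0).hasDerivAt).const_mul C
  have h := hl.unique (hr.congr_of_eventuallyEq (Filter.Eventually.of_forall hC))
  rw [theta1_zero, mul_zero, zero_add] at h
  exact h

lemma theta1Cofactor_ne_zero (him : 0 < τ.im) {x : ℂ} (hx : theta1 x τ ≠ 0) :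
    ∃ z, theta1Cofactor m s τ z ≠ 0 := by
  have hprod : ∀ n : ℕ, ∃ z, ∏ j ∈ Finset.range n, theta1 (z + ((j : ℂ) + 1) * s) τ ≠ 0 := by
    intro n
    induction n with
    | zero => exact ⟨0, by simp⟩
    | succ n ih =>
      by_contra! h
      obtain ⟨y, hy⟩ := ih
      have htheta : ∀ j : ℕ, Differentiable ℂ fun z => theta1 (z + ((j : ℂ) + 1) * s) τ :=
        fun j => (differentiable_theta1 him).comp
          (by fun_prop : Differentiable ℂ fun z : ℂ => z + ((j : ℂ) + 1) * s)
      have hdiff : Differentiable ℂ fun z =>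
          ∏ j ∈ Finset.range n, theta1 (z + ((j : ℂ) + 1) * s) τ :=
        Differentiable.fun_finsetProd fun j _ => htheta j
      rcases AnalyticOnNhd.eq_zero_or_eq_zero_of_mul_eq_zero (U := Set.univ)
        (fun z _ => hdiff.analyticAt z) (fun z _ => (htheta n).analyticAt z)
        (fun z _ => by simpa only [Finset.prod_range_succ] using h z)
        isPreconnected_univ with h0 | h0
      · exact hy (h0 y trivial)
      · exact hx (by simpa using h0 (x - ((n : ℂ) + 1) * s) trivial)
  obtain ⟨z, hz⟩ := hprod m
  exact ⟨z, mul_ne_zero (Complex.exp_ne_zero _) hz⟩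

end Cofactor

/-- `σ_μ(·, τ)` is the average of the `σ_{(μ + c + n) / k}(·, τ / k)`, in a form free of
denominators depending on the variable. -/
lemma theta1Cofactor_mul_sigma {m : ℕ} {s τ : ℂ} (him : 0 < τ.im) (hims : 0 < s.im)
    (hs : τ = (m + 1) * s) {C : ℂ}
    (hC : ∀ z, theta1Cofactor m s τ z * theta1 z τ = C * theta1 z s) {μ : ℂ}
    (hμ : theta1 (-μ) τ ≠ 0) (n : ℤ)
    (hne : ∀ c : ZMod (m + 1), theta1 (-((μ + c.val + n) / (m + 1 : ℕ))) s ≠ 0) (w : ℂ) :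
    (m + 1 : ℕ) * (theta1Cofactor m s τ w *
        (theta1 (w - μ) τ * (theta1'0 τ / theta1 (-μ) τ))) =
      C * ((∑ c : ZMod (m + 1), theta1 (w - (μ + c.val + n) / (m + 1 : ℕ)) s /
        theta1 (-((μ + c.val + n) / (m + 1 : ℕ))) s) * theta1'0 s) := by
  have hne' : ∀ c ∈ Finset.range (m + 1), theta1 (-((μ + c + n) / (m + 1 : ℕ))) s ≠ 0 :=
    fun c hc => by
      have h := hne (c : ZMod (m + 1))
      rwa [ZMod.val_natCast_of_lt (Finset.mem_range.mp hc)] at h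
  have hsum : ∑ c : ZMod (m + 1), theta1 (w - (μ + c.val + n) / (m + 1 : ℕ)) s /
        theta1 (-((μ + c.val + n) / (m + 1 : ℕ))) s =
      ∑ c ∈ Finset.range (m + 1), theta1 (w - (μ + c + n) / (m + 1 : ℕ)) s /
        theta1 (-((μ + c + n) / (m + 1 : ℕ))) s :=
    Fin.sum_univ_eq_sum_range (fun c : ℕ => theta1 (w - (μ + c + n) / (m + 1 : ℕ)) s /
        theta1 (-((μ + c + n) / (m + 1 : ℕ))) s) (m + 1)
  have hexp := theta1Cofactor_mul_theta1_sub him hims hs μ n hne' w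
  rw [← Finset.mul_sum, ← hsum] at hexp
  have hderiv := theta1Cofactor_zero_mul_theta1'0 him hims hC
  set S := ∑ c : ZMod (m + 1), theta1 (w - (μ + c.val + n) / (m + 1 : ℕ)) s /
        theta1 (-((μ + c.val + n) / (m + 1 : ℕ))) s
  calc _ = (m + 1 : ℕ) * (theta1Cofactor m s τ w * theta1 (w - μ) τ) *
        (theta1'0 τ / theta1 (-μ) τ) := by ring
    _ = theta1Cofactor m s τ 0 * theta1'0 τ * S := by
      rw [hexp]
      field_simp
    _ = _ := by rw [hderiv]; ring

/-- the matrix elements of the modified type-I K-operator in the theta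
basis: K_k(ξ)θ_a = Σ_{c∈ℤ_k} K_k(ξ)_{a,c} θ_c, pointwise where the σ's are defined and
for generic ν, ξ. -/
theorem belavin_K_matrix_elements (τ : ℂ) (hτ : 0 < τ.im) (k : ℕ) [NeZero k]
    (ν ξ : ℂ) (a : ZMod k)
    (hgen1 : ∀ c : ZMod k, theta1 ((2 * ν + (c.val : ℂ) + (a.val : ℂ)) / k) (τ / k) ≠ 0)
    (hgen2 : ∀ c : ZMod k, theta1 ((-2 * ξ - (c.val : ℂ) + (a.val : ℂ)) / k) (τ / k) ≠ 0)
    (hgen3 : thetaA τ k a ((-ν + ξ) / k) ≠ 0)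
    (hξ0 : theta1 (-(2 * ξ)) τ ≠ 0) (hν0 : theta1 (-(2 * ν)) τ ≠ 0)
    (z : ℂ) (hz : theta1 (z + (ξ + ν) / k) τ ≠ 0) :
    sigmaE τ (2 * ξ) (z + (ξ + ν) / k) * thetaA τ k a (z + 2 * ξ / k) -
      sigmaE τ (2 * ν) (z + (ξ + ν) / k) * thetaA τ k a (-z - 2 * ν / k) =
    ∑ c : ZMod k, belavinKI τ k ν ξ a c * thetaA τ k c z := by
  obtain ⟨m, rfl⟩ : ∃ m, k = m + 1 := Nat.exists_eq_succ_of_ne_zero (NeZero.ne k)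
  have hm : ((m + 1 : ℕ) : ℂ) ≠ 0 := Nat.cast_ne_zero.mpr (by omega)
  simp only [thetaA_eq_jacobiTheta₂, belavinKI] at hgen3 ⊢
  set s := τ / (m + 1 : ℕ) with hsdef
  have hs : τ = (m + 1) * s := by
    rw [hsdef]
    push_cast at hm ⊢
    field_simp
  have hims : 0 < s.im := by
    rw [hsdef, Complex.div_natCast_im]
    positivity
  obtain ⟨C, hC⟩ := exists_theta1Cofactor_mul_theta1 hτ hims hs
  set A : ZMod (m + 1) → ℂ := fun c => (2 * ξ + c.val + (-a.val : ℤ)) / (m + 1 : ℕ) with hA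
  set B : ZMod (m + 1) → ℂ := fun c => (2 * ν + c.val + (a.val : ℤ)) / (m + 1 : ℕ) with hB
  have hAne : ∀ c, theta1 (-A c) s ≠ 0 := fun c => by
    convert hgen2 c using 2
    rw [hA]
    push_cast
    ring
  have hBne : ∀ c, theta1 (B c) s ≠ 0 := fun c => by
    convert hgen1 c using 2
    rw [hB]
    push_cast
    ring
  have hBne' : ∀ c, theta1 (-B c) s ≠ 0 := fun c => by
    rw [theta1_neg]
    exact neg_ne_zero.mpr (hBne c)
  have hξsum := theta1Cofactor_mul_sigma hτ hims hs hC hξ0 (-a.val) hAne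
  have hνsum := theta1Cofactor_mul_sigma hτ hims hs hC hν0 a.val hBne'
  have hd : ∀ c, (-ν + ξ) / (m + 1 : ℕ) - a.val / (m + 1 : ℕ) = (A c - B c) / 2 := fun c => by
    simp only [hA, hB]
    push_cast
    ring
  set K : ZMod (m + 1) → ℂ := fun c =>
    theta1 ((2 * ν + 2 * (a.val : ℂ) - 2 * ξ) / (m + 1 : ℕ)) s * theta1'0 s /
      ((m + 1 : ℕ) * theta1 ((2 * ν + c.val + a.val) / (m + 1 : ℕ)) s *
        theta1 ((-2 * ξ - c.val + a.val) / (m + 1 : ℕ)) s) *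
      (jacobiTheta₂ ((-ν - ξ) / (m + 1 : ℕ) - c.val / (m + 1 : ℕ)) s /
        jacobiTheta₂ ((-ν + ξ) / (m + 1 : ℕ) - a.val / (m + 1 : ℕ)) s) with hK
  have hJ : ∀ b : ℂ, Differentiable ℂ fun w => jacobiTheta₂ (w + b) s := fun b =>
    Differentiable.comp (g := fun z => jacobiTheta₂ z s)
      (fun z => differentiableAt_jacobiTheta₂_fst z hims)
      (by fun_prop : Differentiable ℂ fun w : ℂ => w + b)
  have hθ : ∀ b : ℂ, Differentiable ℂ fun w => theta1 (w - b) τ := fun b =>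
    (differentiable_theta1 hτ).comp (by fun_prop : Differentiable ℂ fun w : ℂ => w - b)
  set d := (-ν + ξ) / (m + 1 : ℕ) - a.val / (m + 1 : ℕ) with hddef
  set e : ZMod (m + 1) → ℂ := fun c => -((ξ + ν) / (m + 1 : ℕ) + c.val / (m + 1 : ℕ)) with he
  have he' : ∀ c, e c = -((A c + B c) / 2) := fun c => by
    simp only [hA, hB, he]
    push_cast
    ring
  set H : ℂ → ℂ := fun w =>
    theta1 (w - 2 * ξ) τ * (theta1'0 τ / theta1 (-(2 * ξ)) τ) * jacobiTheta₂ (w + d) s -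
    theta1 (w - 2 * ν) τ * (theta1'0 τ / theta1 (-(2 * ν)) τ) * jacobiTheta₂ (w + -d) s -
    theta1 (w - 0) τ * ∑ c, K c * jacobiTheta₂ (w + e c) s with hH
  have hHdiff : Differentiable ℂ H :=
    ((((hθ _).mul_const _).mul (hJ _)).sub (((hθ _).mul_const _).mul (hJ _))).sub
      ((hθ 0).mul (Differentiable.fun_sum fun c _ => (hJ _).const_mul _))
  have hGH : ∀ w, theta1Cofactor m s τ w * H w = 0 := fun w => by
    have hbracket : ∀ c, theta1 (w - A c) s / theta1 (-A c) s * jacobiTheta₂ (w + d) s -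
        theta1 (w - B c) s / theta1 (-B c) s * jacobiTheta₂ (w + -d) s =
        theta1 w s * (theta1 (B c - A c) s / (theta1 (B c) s * theta1 (-A c) s) *
          (jacobiTheta₂ (e c) s / jacobiTheta₂ d s) * jacobiTheta₂ (w + e c) s) := fun c => by
      have h := theta1_mul_jacobiTheta₂_three_term hims w (A c) (B c)
      rw [← hd c, ← he' c, sub_eq_add_neg w d, sub_eq_add_neg w ((A c + B c) / 2), ← he' c] at h
      have h1 := hAne c
      have h2 := hBne c
      rw [theta1_neg (B c)]
      field_simp
      linear_combination h
    have hKc : ∀ c, (m + 1 : ℕ) * K c = theta1'0 s *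
        (theta1 (B c - A c) s / (theta1 (B c) s * theta1 (-A c) s) *
          (jacobiTheta₂ (e c) s / jacobiTheta₂ d s)) := fun c => by
      have h1 : (2 * ν + 2 * (a.val : ℂ) - 2 * ξ) / (m + 1 : ℕ) = B c - A c := by
        simp only [hA, hB]; push_cast; ring
      have h2 : (2 * ν + c.val + a.val) / (m + 1 : ℕ) = B c := by
        simp only [hB]; push_cast; ring
      have h3 : (-2 * ξ - c.val + a.val) / (m + 1 : ℕ) = -A c := by
        simp only [hA]; push_cast; ring
      have h4 : (-ν - ξ) / (m + 1 : ℕ) - c.val / (m + 1 : ℕ) = e c := by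
        simp only [he]; ring
      simp only [hK, h1, h2, h3, h4]
      have h5 := hAne c
      have h6 := hBne c
      field_simp
    have hsum : ∑ c, (theta1 (w - A c) s / theta1 (-A c) s) * theta1'0 s *
        jacobiTheta₂ (w + d) s - ∑ c, (theta1 (w - B c) s / theta1 (-B c) s) * theta1'0 s *
        jacobiTheta₂ (w + -d) s =
        (m + 1 : ℕ) * (theta1 w s * ∑ c, K c * jacobiTheta₂ (w + e c) s) := by
      rw [Finset.mul_sum, Finset.mul_sum, ← Finset.sum_sub_distrib]
      refine Finset.sum_congr rfl fun c _ => ?_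
      linear_combination theta1'0 s * hbracket c -
        theta1 w s * jacobiTheta₂ (w + e c) s * hKc c
    rw [← Finset.sum_mul, ← Finset.sum_mul, ← Finset.sum_mul, ← Finset.sum_mul] at hsum
    refine (mul_eq_zero.mp ?_).resolve_left hm
    simp only [hH, sub_zero]
    linear_combination jacobiTheta₂ (w + d) s * hξsum w - jacobiTheta₂ (w + -d) s * hνsum w +
      C * hsum - (m + 1 : ℕ) * (∑ c, K c * jacobiTheta₂ (w + e c) s) * hC w
  have hH0 : ∀ w, H w = 0 := by
    obtain ⟨x, hx⟩ := theta1Cofactor_ne_zero (m := m) (s := s) hτ hξ0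
    rcases AnalyticOnNhd.eq_zero_or_eq_zero_of_mul_eq_zero (U := Set.univ)
      (fun z _ => (differentiable_theta1Cofactor hτ).analyticAt z)
      (fun z _ => hHdiff.analyticAt z) (fun z _ => hGH z) isPreconnected_univ with h | h
    · exact absurd (h x trivial) hx
    · exact fun w => h w trivial
  have hz' := hH0 (z + (ξ + ν) / (m + 1 : ℕ))
  have h1 : z + 2 * ξ / (m + 1 : ℕ) - a.val / (m + 1 : ℕ) = z + (ξ + ν) / (m + 1 : ℕ) + d := by
    rw [hddef]; ring
  have h2 : -z - 2 * ν / (m + 1 : ℕ) - a.val / (m + 1 : ℕ) =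
      -(z + (ξ + ν) / (m + 1 : ℕ) + -d) := by
    rw [hddef]; ring
  have h3 : ∀ c : ZMod (m + 1), z - c.val / (m + 1 : ℕ) = z + (ξ + ν) / (m + 1 : ℕ) + e c :=
    fun c => by rw [he]; ring
  simp only [hH, sub_zero] at hz'
  simp only [h1, h2, h3, jacobiTheta₂_neg_left, sigmaE]
  change _ = ∑ c, K c * jacobiTheta₂ (z + (ξ + ν) / (m + 1 : ℕ) + e c) s
  generalize z + (ξ + ν) / ((m + 1 : ℕ) : ℂ) = w at hz hz' ⊢
  have hcancel : ∀ X D Y : ℂ, theta1 w τ * (X * D / (theta1 w τ * Y)) = X * (D / Y) :=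
    fun X D Y => by field_simp
  apply mul_left_cancel₀ hz
  linear_combination hz' + jacobiTheta₂ (w + d) s *
      hcancel (theta1 (w - 2 * ξ) τ) (theta1'0 τ) (theta1 (-(2 * ξ)) τ) -
    jacobiTheta₂ (w + -d) s *
      hcancel (theta1 (w - 2 * ν) τ) (theta1'0 τ) (theta1 (-(2 * ν)) τ)
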